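/- Let θ be a CPWL function, let φ₀ and Φ be twice continuously differentiable around x̄ in the composite optimization setting, assume 0 ∈ aff ∂θ(z̄) and the nondegeneracy condition aff ∂θ(z̄) ∩ ker ∇Φ(x̄)* = {0}, where aff denotes the affine hull, and suppose x̄ is a tilt-stable local minimizer: there exists γ > 0 such that the map p₁ ↦ M_γ(p₁) := argmin{φ₀(x) + θ(Φ(x)) − ⟨p₁,x⟩ : ‖x − x̄‖ ≤ γ} is single-valued and Lipschitz continuous on a neighborhood of 0 ∈ ℝ^n with M_γ(0) = {x̄}. Then Λ_com(x̄) is a singleton {v̄}, and the unique multiplier v̄ is noncritical. -/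

import Mathlib

open Filter Topology Set RealInnerProductSpace

noncomputable section

abbrev Ev (k : ℕ) := EuclideanSpace ℝ (Fin k)

/-- The Bouligand–Severi tangent cone to a set `s` at `x`. -/
def tcone {E : Type*} [NormedAddCommGroup E] [NormedSpace ℝ E] (s : Set E) (x : E) : Set E :=
  {w | ∃ (z : ℕ → E) (c : ℕ → ℝ), (∀ k, z k ∈ s) ∧ (∀ k, 0 ≤ c k) ∧
      Tendsto z atTop (𝓝 x) ∧ Tendsto (fun k => c k • (z k - x)) atTop (𝓝 w)}

/-- The data of a convex piecewise linear (CPWL) extended-real-valued function on `ℝ^m`: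
`θ(z) = max_i (⟨a i, z⟩ - al i)` on the polyhedron `dom θ = {z | ⟨d i, z⟩ ≤ be i ∀ i}`,
and `θ(z) = +∞` outside of it. -/
structure CPWL (m : ℕ) where
  l : ℕ
  p : ℕ
  hl : 0 < l
  a : Fin l → Ev m
  al : Fin l → ℝ
  d : Fin p → Ev m
  be : Fin p → ℝ
  dom_nonempty : ∃ z : Ev m, ∀ i, ⟪d i, z⟫ ≤ be i

namespace CPWL

variable {m : ℕ} (θ : CPWL m)

/-- The (polyhedral) domain of the CPWL function. -/
def dom : Set (Ev m) := {z | ∀ i, ⟪θ.d i, z⟫ ≤ θ.be i}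

/-- The real value `max_i (⟨a i, z⟩ - al i)` of the CPWL function (meaningful on its domain). -/
def val (z : Ev m) : ℝ := ⨆ i : Fin θ.l, (⟪θ.a i, z⟫ - θ.al i)

/-- The CPWL function as an extended-real-valued function. -/
def eval (z : Ev m) : EReal :=
  @ite _ (z ∈ θ.dom) (Classical.propDecidable _) ((θ.val z : ℝ) : EReal) ⊤

/-- The subdifferential (of convex analysis) of the CPWL function. -/
def subdiff (z : Ev m) : Set (Ev m) :=
  {v | z ∈ θ.dom ∧ ∀ z' ∈ θ.dom, ⟪v, z' - z⟫ ≤ θ.val z' - θ.val z}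

/-- Active indices `K(z)` of the max-representation. -/
def Kact (z : Ev m) : Set (Fin θ.l) := {i | θ.val z = ⟪θ.a i, z⟫ - θ.al i}

/-- Active indices `I(z)` of the domain constraints. -/
def Iact (z : Ev m) : Set (Fin θ.p) := {i | ⟪θ.d i, z⟫ = θ.be i}

/-- The critical cone `𝒦(z̄,v̄) = {w ∈ T(z̄; dom θ) : ⟨v̄,w⟩ = θ′(z̄;w)}`. -/
def crit (zb vb : Ev m) : Set (Ev m) :=
  {w | w ∈ tcone θ.dom zb ∧
    Tendsto (fun t : ℝ => (θ.val (zb + t • w) - θ.val zb) / t) (𝓝[>] (0 : ℝ))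
      (𝓝 ⟪vb, w⟫)}

/-- The graph of the subdifferential mapping. -/
def gph : Set (Ev m × Ev m) := {zv | zv.2 ∈ θ.subdiff zv.1}

/-- The graphical derivative `(D∂θ)(z̄,v̄)(u)`. -/
def Dsub (zb vb u : Ev m) : Set (Ev m) := {w | (u, w) ∈ tcone θ.gph (zb, vb)}

/-- The regular coderivative `(D̂*∂θ)(z̄,v̄)(u)`. -/
def Dhat (zb vb u : Ev m) : Set (Ev m) :=
  {w | ∀ h ∈ tcone θ.gph (zb, vb), ⟪w, h.1⟫ - ⟪u, h.2⟫ ≤ 0}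

end CPWL

section VarSys

variable {n m : ℕ}

/-- The adjoint `∇Φ(x)*` of the Jacobian of `Φ` at `x`. -/
def adjD (Φ : Ev n → Ev m) (x : Ev n) : Ev m →L[ℝ] Ev n :=
  ContinuousLinearMap.adjoint (fderiv ℝ Φ x)

/-- `Ψ(x,v) = f(x) + ∇Φ(x)* v`. -/
def Psi (f : Ev n → Ev n) (Φ : Ev n → Ev m) (x : Ev n) (v : Ev m) : Ev n :=
  f x + adjD Φ x v

/-- The partial Jacobian `∇ₓΨ(x̄,v̄)`. -/
def gradxPsi (f : Ev n → Ev n) (Φ : Ev n → Ev m) (xb : Ev n) (vb : Ev m) :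
    Ev n →L[ℝ] Ev n :=
  fderiv ℝ (fun x => Psi f Φ x vb) xb

/-- The Lagrange multiplier set `Λ(x̄)` of the variational system. -/
def Lam (f : Ev n → Ev n) (Φ : Ev n → Ev m) (θ : CPWL m) (xb : Ev n) : Set (Ev m) :=
  {v | Psi f Φ xb v = 0 ∧ v ∈ θ.subdiff (Φ xb)}

/-- `v̄` is a critical multiplier for the variational system. -/
def IsCritical (f : Ev n → Ev n) (Φ : Ev n → Ev m) (θ : CPWL m) (xb : Ev n) (vb : Ev m) :
    Prop :=
  ∃ ξ : Ev n, ξ ≠ 0 ∧ ∃ w ∈ θ.Dsub (Φ xb) vb (fderiv ℝ Φ xb ξ),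
    gradxPsi f Φ xb vb ξ + adjD Φ xb w = 0

/-- The solution map of the canonically perturbed variational system. -/
def Smap (f : Ev n → Ev n) (Φ : Ev n → Ev m) (θ : CPWL m) (p₁ : Ev n) (p₂ : Ev m) :
    Set (Ev n × Ev m) :=
  {xv | Psi f Φ xv.1 xv.2 = p₁ ∧ xv.2 ∈ θ.subdiff (Φ xv.1 + p₂)}

end VarSys

section General

variable {n m : ℕ}

/-- The subdifferential of a general extended-real-valued function. -/
def subdiffE (θ : Ev m → EReal) (z : Ev m) : Set (Ev m) :=
  {v | ∀ z', ((⟪v, z' - z⟫ : ℝ) : EReal) ≤ θ z' - θ z}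

/-- The graph of the subdifferential of a general extended-real-valued function. -/
def gphE (θ : Ev m → EReal) : Set (Ev m × Ev m) := {zv | zv.2 ∈ subdiffE θ zv.1}

/-- The graphical derivative of the subdifferential, general case. -/
def DsubE (θ : Ev m → EReal) (zb vb u : Ev m) : Set (Ev m) :=
  {w | (u, w) ∈ tcone (gphE θ) (zb, vb)}

/-- The Lagrange multiplier set, general case. -/
def LamE (f : Ev n → Ev n) (Φ : Ev n → Ev m) (θ : Ev m → EReal) (xb : Ev n) :
    Set (Ev m) :=
  {v | Psi f Φ xb v = 0 ∧ v ∈ subdiffE θ (Φ xb)}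

/-- The solution map of the canonically perturbed variational system, general case. -/
def SmapE (f : Ev n → Ev n) (Φ : Ev n → Ev m) (θ : Ev m → EReal) (p₁ : Ev n)
    (p₂ : Ev m) : Set (Ev n × Ev m) :=
  {xv | Psi f Φ xv.1 xv.2 = p₁ ∧ xv.2 ∈ subdiffE θ (Φ xv.1 + p₂)}

end General

section Composite

variable {n m : ℕ}

/-- The gradient `∇ₓL(·,v)` of the Lagrangian `L(x,v) = φ₀(x) + ⟨Φ(x),v⟩`. -/
def gradL (φ₀ : Ev n → ℝ) (Φ : Ev n → Ev m) (v : Ev m) (x : Ev n) : Ev n :=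
  gradient (fun y => φ₀ y + ⟪Φ y, v⟫) x

/-- The Hessian `∇²ₓₓL(x̄,v)` as a linear operator. -/
def HessOp (φ₀ : Ev n → ℝ) (Φ : Ev n → Ev m) (v : Ev m) (xb : Ev n) : Ev n →L[ℝ] Ev n :=
  fderiv ℝ (gradL φ₀ Φ v) xb

/-- The Lagrange multiplier set `Λ_com(x̄)` of the composite optimization problem. -/
def LamCom (φ₀ : Ev n → ℝ) (Φ : Ev n → Ev m) (θ : CPWL m) (xb : Ev n) : Set (Ev m) :=
  {v | gradient φ₀ xb + adjD Φ xb v = 0 ∧ v ∈ θ.subdiff (Φ xb)}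

/-- Criticality of a multiplier in the composite optimization setting. -/
def IsCriticalCom (φ₀ : Ev n → ℝ) (Φ : Ev n → Ev m) (θ : CPWL m) (xb : Ev n) (v : Ev m) :
    Prop :=
  ∃ ξ : Ev n, ξ ≠ 0 ∧ ∃ w ∈ θ.Dsub (Φ xb) v (fderiv ℝ Φ xb ξ),
    HessOp φ₀ Φ v xb ξ + adjD Φ xb w = 0

/-- The solution map of the canonically perturbed KKT system of composite optimization. -/
def SKKT (φ₀ : Ev n → ℝ) (Φ : Ev n → Ev m) (θ : CPWL m) (p₁ : Ev n) (p₂ : Ev m) :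
    Set (Ev n × Ev m) :=
  {xv | gradient φ₀ xv.1 + adjD Φ xv.1 xv.2 = p₁ ∧ xv.2 ∈ θ.subdiff (Φ xv.1 + p₂)}

/-- `x̄` is a local minimizer of `φ₀ + θ∘Φ`. -/
def LocalMin (φ₀ : Ev n → ℝ) (Φ : Ev n → Ev m) (θ : CPWL m) (xb : Ev n) : Prop :=
  ∃ U ∈ 𝓝 xb, ∀ x ∈ U,
    ((φ₀ xb : ℝ) : EReal) + θ.eval (Φ xb) ≤ ((φ₀ x : ℝ) : EReal) + θ.eval (Φ x)

end Composite

section Calmness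

variable {n m : ℕ}

/-- Isolated calmness of a solution map at `((0,0), q0)`. -/
def IsolCalm (S : Ev n × Ev m → Set (Ev n × Ev m)) (q0 : Ev n × Ev m) : Prop :=
  ∃ c : ℝ, 0 ≤ c ∧ ∃ U ∈ 𝓝 (0 : Ev n × Ev m), ∃ V ∈ 𝓝 q0,
    ∀ p ∈ U, ∀ q ∈ S p ∩ V, ‖q - q0‖ ≤ c * (‖p.1‖ + ‖p.2‖)

/-- Robust isolated calmness of a solution map at `((0,0), q0)`. -/
def RobustIsolCalm (S : Ev n × Ev m → Set (Ev n × Ev m)) (q0 : Ev n × Ev m) : Prop :=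
  ∃ c : ℝ, 0 ≤ c ∧ ∃ U ∈ 𝓝 (0 : Ev n × Ev m), ∃ V ∈ 𝓝 q0,
    (∀ p ∈ U, ∀ q ∈ S p ∩ V, ‖q - q0‖ ≤ c * (‖p.1‖ + ‖p.2‖)) ∧
    (∀ p ∈ U, (S p ∩ V).Nonempty)

/-- The Lipschitz-like (Aubin) property of a solution map around `((0,0), q0)`. -/
def LipschitzLike (S : Ev n × Ev m → Set (Ev n × Ev m)) (q0 : Ev n × Ev m) : Prop :=
  ∃ c : ℝ, 0 ≤ c ∧ ∃ U ∈ 𝓝 (0 : Ev n × Ev m), ∃ V ∈ 𝓝 q0,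
    ∀ p ∈ U, ∀ p' ∈ U, ∀ q ∈ S p ∩ V, ∃ q' ∈ S p', ‖q - q'‖ ≤ c * ‖p - p'‖

end Calmness

/-- The extended-real-valued objective of the tilt-perturbed composite problem. -/
def objT {n m : ℕ} (φ₀ : Ev n → ℝ) (Φ : Ev n → Ev m) (θ : CPWL m)
    (p₁ : Ev n) (x : Ev n) : EReal :=
  ((φ₀ x - ⟪p₁, x⟫ : ℝ) : EReal) + θ.eval (Φ x)

/-- The localized argmin set of the tilt-perturbed problem. -/
def Mtilt {n m : ℕ} (φ₀ : Ev n → ℝ) (Φ : Ev n → Ev m) (θ : CPWL m) (xb : Ev n)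
    (γ : ℝ) (p₁ : Ev n) : Set (Ev n) :=
  {x | ‖x - xb‖ ≤ γ ∧ objT φ₀ Φ θ p₁ x ≠ ⊤ ∧
    ∀ y : Ev n, ‖y - xb‖ ≤ γ → objT φ₀ Φ θ p₁ x ≤ objT φ₀ Φ θ p₁ y}

theorem CPWL.le_val {m : ℕ} (θ : CPWL m) (z : Ev m) (i : Fin θ.l) :
    ⟪θ.a i, z⟫ - θ.al i ≤ θ.val z :=
  le_ciSup (f := fun i : Fin θ.l => ⟪θ.a i, z⟫ - θ.al i) (Set.finite_range _).bddAbove i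

theorem CPWL.exists_act {m : ℕ} (θ : CPWL m) (z : Ev m) : ∃ i, i ∈ θ.Kact z := by
  have : Nonempty (Fin θ.l) := ⟨⟨0, θ.hl⟩⟩
  obtain ⟨i, hi⟩ := exists_eq_ciSup_of_finite (f := fun i : Fin θ.l => ⟪θ.a i, z⟫ - θ.al i)
  exact ⟨i, hi.symm⟩

theorem CPWL.val_le {m : ℕ} (θ : CPWL m) (z : Ev m) (r : ℝ)
    (h : ∀ i, ⟪θ.a i, z⟫ - θ.al i ≤ r) : θ.val z ≤ r := by
  have : Nonempty (Fin θ.l) := ⟨⟨0, θ.hl⟩⟩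
  exact ciSup_le h

theorem CPWL.act_mem {m : ℕ} (θ : CPWL m) (z : Ev m) (hz : z ∈ θ.dom) (i : Fin θ.l)
    (hi : i ∈ θ.Kact z) : θ.a i ∈ θ.subdiff z := by
  refine ⟨hz, fun z' _ => ?_⟩
  have h1 := θ.le_val z' i
  have h2 : θ.val z = ⟪θ.a i, z⟫ - θ.al i := hi
  rw [inner_sub_right]
  linarith

theorem CPWL.add_mem {m : ℕ} (θ : CPWL m) (z v : Ev m) (hv : v ∈ θ.subdiff z) (i : Fin θ.p)
    (hi : i ∈ θ.Iact z) (s : ℝ) (hs : 0 ≤ s) : v + s • θ.d i ∈ θ.subdiff z := by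
  refine ⟨hv.1, fun z' hz' => ?_⟩
  have h1 := hv.2 z' hz'
  have h2 : ⟪θ.d i, z⟫ = θ.be i := hi
  have h3 : ⟪θ.d i, z'⟫ ≤ θ.be i := hz' i
  have h4 : ⟪θ.d i, z' - z⟫ ≤ 0 := by rw [inner_sub_right]; linarith
  rw [inner_add_left, real_inner_smul_left]
  nlinarith

theorem CPWL.subdiff_convex {m : ℕ} (θ : CPWL m) (z : Ev m) : Convex ℝ (θ.subdiff z) := by
  intro u hu v hv a b ha hb hab
  refine ⟨hu.1, fun z' hz' => ?_⟩
  rw [inner_add_left, real_inner_smul_left, real_inner_smul_left]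
  have h1 := mul_le_mul_of_nonneg_left (hu.2 z' hz') ha
  have h2 := mul_le_mul_of_nonneg_left (hv.2 z' hz') hb
  calc _ ≤ a * (θ.val z' - θ.val z) + b * (θ.val z' - θ.val z) := add_le_add h1 h2
    _ = (a + b) * (θ.val z' - θ.val z) := by ring
    _ = _ := by rw [hab, one_mul]

theorem CPWL.subdiff_closed {m : ℕ} (θ : CPWL m) (z : Ev m) (hz : z ∈ θ.dom) :
    IsClosed (θ.subdiff z) := by
  have : θ.subdiff z = ⋂ z' ∈ θ.dom, {v : Ev m | ⟪v, z' - z⟫ ≤ θ.val z' - θ.val z} := by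
    ext v
    simp [CPWL.subdiff, hz]
  rw [this]
  refine isClosed_biInter fun z' _ => ?_
  exact isClosed_le (by fun_prop) continuous_const

theorem submersion_curve {E V : Type*} [NormedAddCommGroup E] [NormedSpace ℝ E] [CompleteSpace E]
    [NormedAddCommGroup V] [NormedSpace ℝ V]
    (F : E → V) (F' : E →L[ℝ] V) (R : V →L[ℝ] E) (hR : ∀ y, F' (R y) = y) (xb : E)
    (hF : HasStrictFDerivAt F F' xb) (ξ : E) :
    ∃ x : ℝ → E, x 0 = xb ∧ HasDerivAt x ξ 0 ∧ ∀ᶠ t in 𝓝 (0 : ℝ), F (x t) - F xb = t • F' ξ := by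
  let G : E → E := fun x => x + R (F x - F xb - F' (x - xb))
  have hG : HasStrictFDerivAt G ((ContinuousLinearEquiv.refl ℝ E : E ≃L[ℝ] E) : E →L[ℝ] E) xb := by
    have h1 : HasStrictFDerivAt (fun x => F x - F xb - F' (x - xb)) (F' - F') xb :=
      (hF.sub_const _).sub (by
        simpa using (F'.hasStrictFDerivAt (x := xb)).sub_const (F' xb))
    have h2 := (hasStrictFDerivAt_id xb).add
      ((R.hasStrictFDerivAt (x := F xb - F xb - F' (xb - xb))).comp xb h1)
    have e : ((ContinuousLinearEquiv.refl ℝ E : E ≃L[ℝ] E) : E →L[ℝ] E)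
        = ContinuousLinearMap.id ℝ E + R.comp (F' - F') := by
      ext y; simp
    rw [e]
    exact h2
  have hGxb : G xb = xb := by simp [G]
  refine ⟨fun t => hG.localInverse G _ _ (xb + t • ξ), ?_, ?_, ?_⟩
  · have := hG.localInverse_apply_image
    rw [hGxb] at this
    simpa using this
  · have h1 := hG.to_localInverse.hasFDerivAt
    rw [hGxb] at h1
    have h2 : HasDerivAt (fun t : ℝ => xb + t • ξ) ξ 0 := by
      simpa using ((hasDerivAt_id (0 : ℝ)).smul_const ξ).const_add xb
    have h3 : HasFDerivAt (hG.localInverse G _ _)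
      ((ContinuousLinearEquiv.refl ℝ E : E ≃L[ℝ] E).symm : E →L[ℝ] E) (xb + (0 : ℝ) • ξ) := by
      simpa using h1
    have h4 := h3.comp_hasDerivAt (0 : ℝ) h2
    exact h4
  · have h1 := hG.eventually_right_inverse
    rw [hGxb] at h1
    have h2 : Tendsto (fun t : ℝ => xb + t • ξ) (𝓝 0) (𝓝 xb) := by
      have : Continuous (fun t : ℝ => xb + t • ξ) := by fun_prop
      simpa using this.tendsto 0
    filter_upwards [h2.eventually h1] with t ht
    set y := hG.localInverse G _ _ (xb + t • ξ) with hy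
    have h3 : y + R (F y - F xb - F' (y - xb)) = xb + t • ξ := ht
    have h4 := congrArg F' h3
    simp only [map_add, hR, map_sub, map_smul] at h4
    calc F y - F xb = (F' y + (F y - F xb - (F' y - F' xb))) - F' xb := by abel
      _ = _ := by rw [h4]; abel

theorem taylor_bound {n : ℕ} (L : Ev n → ℝ) (xb : Ev n) (hL : ContDiffAt ℝ 2 L xb)
    (hg : gradient L xb = 0) (ε : ℝ) (hε : 0 < ε) :
    ∀ᶠ y in 𝓝 xb, |L y - L xb - (1/2) * ⟪fderiv ℝ (gradient L) xb (y - xb), y - xb⟫|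
      ≤ ε * ‖y - xb‖ ^ 2 := by
  set H := fderiv ℝ (gradient L) xb with hH
  have hd : DifferentiableAt ℝ (gradient L) xb := by
    have h1 : DifferentiableAt ℝ (fderiv ℝ L) xb :=
      (hL.fderiv_right (m := 1) (by norm_num)).differentiableAt (by norm_num)
    exact ((InnerProductSpace.toDual ℝ (Ev n)).symm.toContinuousLinearEquiv.differentiable
      _).comp xb h1
  have h1 : ∀ᶠ y in 𝓝 xb, ‖gradient L y - gradient L xb - H (y - xb)‖ ≤ ε * ‖y - xb‖ :=
    hd.hasFDerivAt.isLittleO.def hε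
  have h2 : ∀ᶠ y in 𝓝 xb, DifferentiableAt ℝ L y := by
    filter_upwards [hL.eventually (by simp)] with y hy
    exact hy.differentiableAt (by norm_num)
  obtain ⟨δ, hδ, hb⟩ := Metric.eventually_nhds_iff_ball.1 (h1.and h2)
  refine Metric.eventually_nhds_iff_ball.2 ⟨δ, hδ, fun y hy => ?_⟩
  set h := y - xb with hh
  have hmem : ∀ s ∈ Icc (0:ℝ) 1, xb + s • h ∈ Metric.ball xb δ := by
    intro s hs
    rw [mem_ball_iff_norm] at hy ⊢
    rw [add_sub_cancel_left, norm_smul, Real.norm_of_nonneg hs.1]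
    have : s * ‖h‖ ≤ 1 * ‖h‖ := mul_le_mul_of_nonneg_right hs.2 (norm_nonneg _)
    linarith
  have key := norm_image_sub_le_of_norm_deriv_le_segment_01'
    (f := fun s : ℝ => L (xb + s • h) - s ^ 2 * ((1/2) * ⟪H h, h⟫))
    (f' := fun s : ℝ => ⟪gradient L (xb + s • h), h⟫ - (2 * s) * ((1/2) * ⟪H h, h⟫))
    (C := ε * ‖h‖ ^ 2) ?_ ?_
  · simp only [one_smul, zero_smul, add_zero, one_pow, one_mul] at key
    rw [Real.norm_eq_abs] at key
    have e : xb + h = y := by simp [hh]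
    rw [e] at key
    convert key using 2
    ring
  · intro s hs
    apply HasDerivAt.hasDerivWithinAt
    have hLd := ((hb _ (hmem s hs)).2).hasGradientAt.hasFDerivAt
    have hline : HasDerivAt (fun s : ℝ => xb + s • h) h s := by
      simpa using ((hasDerivAt_id s).smul_const h).const_add xb
    have := hLd.comp_hasDerivAt s hline
    refine HasDerivAt.sub (f := fun s : ℝ => L (xb + s • h)) this ?_
    simpa using (hasDerivAt_pow 2 s).mul_const ((1/2) * ⟪H h, h⟫)
  · intro s hs
    have hs' : s ∈ Icc (0:ℝ) 1 := ⟨hs.1, hs.2.le⟩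
    have h3 := (hb _ (hmem s hs')).1
    rw [hg, add_sub_cancel_left, sub_zero, map_smul, norm_smul, Real.norm_of_nonneg hs.1] at h3
    have e : ⟪gradient L (xb + s • h), h⟫ - (2 * s) * ((1/2) * ⟪H h, h⟫)
        = ⟪gradient L (xb + s • h) - s • H h, h⟫ := by
      rw [inner_sub_left, real_inner_smul_left]; ring
    rw [e]
    refine (norm_inner_le_norm _ _).trans ?_
    have h4 : s * ‖h‖ ≤ ‖h‖ := by nlinarith [norm_nonneg h, hs.2]
    have h5 : ‖gradient L (xb + s • h) - s • H h‖ ≤ ε * ‖h‖ :=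
      h3.trans (mul_le_mul_of_nonneg_left h4 hε.le)
    calc _ ≤ ε * ‖h‖ * ‖h‖ := mul_le_mul_of_nonneg_right h5 (norm_nonneg _)
      _ = _ := by ring

theorem second_order {n : ℕ} (L : Ev n → ℝ) (xb ξ : Ev n) (hL : ContDiffAt ℝ 2 L xb)
    (hg : gradient L xb = 0) (κ : ℝ) (hκ : 0 < κ) (x : ℝ → Ev n) (hx0 : x 0 = xb)
    (hx : HasDerivAt x ξ 0) (hξ : ξ ≠ 0)
    (hgr : ∀ᶠ t in 𝓝[>] (0:ℝ), κ * ‖x t - xb‖ ^ 2 ≤ L (x t) - L xb) :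
    0 < ⟪fderiv ℝ (gradient L) xb ξ, ξ⟫ := by
  set H := fderiv ℝ (gradient L) xb with hH
  have hT := taylor_bound L xb hL hg (κ / 2) (by positivity)
  have hxt : Tendsto x (𝓝[>] 0) (𝓝 xb) := by
    have := hx.continuousAt.tendsto
    rw [hx0] at this
    exact this.mono_left nhdsWithin_le_nhds
  have hsl : Tendsto (fun t : ℝ => t⁻¹ • (x t - xb)) (𝓝[>] 0) (𝓝 ξ) := by
    have := hasDerivAt_iff_tendsto_slope_zero.1 hx
    simp only [zero_add, hx0] at this
    exact this.mono_left (nhdsWithin_mono _ fun t ht => ne_of_gt ht)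
  have hlim1 : Tendsto (fun t : ℝ => κ * ‖t⁻¹ • (x t - xb)‖ ^ 2) (𝓝[>] 0) (𝓝 (κ * ‖ξ‖ ^ 2)) :=
    (hsl.norm.pow 2).const_mul κ
  have hlim2 : Tendsto (fun t : ℝ => ⟪H (t⁻¹ • (x t - xb)), t⁻¹ • (x t - xb)⟫) (𝓝[>] 0)
      (𝓝 ⟪H ξ, ξ⟫) := ((H.continuous.tendsto ξ).comp hsl).inner hsl
  have hle : κ * ‖ξ‖ ^ 2 ≤ ⟪H ξ, ξ⟫ := by
    refine le_of_tendsto_of_tendsto hlim1 hlim2 ?_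
    filter_upwards [hgr, hxt.eventually hT, self_mem_nhdsWithin] with t h1 h2 ht
    have ht : 0 < t := ht
    have h3 := (abs_le.1 h2).2
    rw [map_smul, real_inner_smul_left, real_inner_smul_right, norm_smul, norm_inv,
      Real.norm_of_nonneg ht.le, mul_pow]
    have h4 : κ * ‖x t - xb‖ ^ 2 ≤ ⟪H (x t - xb), x t - xb⟫ := by linarith
    have h5 := mul_le_mul_of_nonneg_left h4 (by positivity : 0 ≤ t⁻¹ ^ 2)
    calc _ = t⁻¹ ^ 2 * (κ * ‖x t - xb‖ ^ 2) := by ring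
      _ ≤ _ := h5
      _ = _ := by ring
  have : 0 < ‖ξ‖ := norm_pos_iff.2 hξ
  have : 0 < κ * ‖ξ‖ ^ 2 := by positivity
  linarith

theorem growth {n m : ℕ} (θ : CPWL m) (φ₀ : Ev n → ℝ) (Φ : Ev n → Ev m) (xb : Ev n)
    (hdom : Φ xb ∈ θ.dom)
    (htilt : ∃ γ : ℝ, 0 < γ ∧ ∃ U ∈ 𝓝 (0 : Ev n),
      ∃ (g : Ev n → Ev n) (c : NNReal), LipschitzOnWith c g U ∧
        (∀ p₁ ∈ U, Mtilt φ₀ Φ θ xb γ p₁ = {g p₁}) ∧ g 0 = xb) :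
    ∃ κ : ℝ, 0 < κ ∧ ∀ᶠ x in 𝓝 xb, Φ x ∈ θ.dom →
      φ₀ xb + θ.val (Φ xb) + κ * ‖x - xb‖ ^ 2 ≤ φ₀ x + θ.val (Φ x) := by
  obtain ⟨γ, hγ, U, hU, g, c, hlip, hM, hg0⟩ := htilt
  have hobj : ∀ p x, Φ x ∈ θ.dom →
      objT φ₀ Φ θ p x = ((φ₀ x - ⟪p, x⟫ + θ.val (Φ x) : ℝ) : EReal) := by
    intro p x hx
    simp [objT, CPWL.eval, hx]
  have hdomT : ∀ p x, objT φ₀ Φ θ p x ≠ ⊤ → Φ x ∈ θ.dom := by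
    intro p x h
    by_contra hx
    apply h
    simp only [objT, CPWL.eval, hx, if_false]
    exact EReal.coe_add_top _
  have h0U : (0 : Ev n) ∈ U := mem_of_mem_nhds hU
  have hmin : ∀ q ∈ U, ‖g q - xb‖ ≤ γ ∧ Φ (g q) ∈ θ.dom ∧
      ∀ x, ‖x - xb‖ ≤ γ → Φ x ∈ θ.dom →
        φ₀ (g q) - ⟪q, g q⟫ + θ.val (Φ (g q)) ≤ φ₀ x - ⟪q, x⟫ + θ.val (Φ x) := by
    intro q hq
    have : g q ∈ Mtilt φ₀ Φ θ xb γ q := by rw [hM q hq]; rfl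
    obtain ⟨h1, h2, h3⟩ := this
    have h4 := hdomT _ _ h2
    refine ⟨h1, h4, fun x hx hxd => ?_⟩
    have := h3 x hx
    rw [hobj _ _ h4, hobj _ _ hxd] at this
    exact_mod_cast this
  set C : ℝ := c + 1 with hC
  have hCpos : 0 < C := by positivity
  refine ⟨1 / (4 * C), by positivity, ?_⟩
  have hq : Tendsto (fun x : Ev n => (1 / (2 * C)) • (x - xb)) (𝓝 xb) (𝓝 0) := by
    have : Continuous (fun x : Ev n => (1 / (2 * C)) • (x - xb)) := by fun_prop
    simpa using this.tendsto xb
  filter_upwards [hq.eventually hU, Metric.closedBall_mem_nhds xb hγ] with x hxU hxγ hxd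
  rw [mem_closedBall_iff_norm] at hxγ
  set q := (1 / (2 * C)) • (x - xb) with hqdef
  have hxU : q ∈ U := hxU
  obtain ⟨k1, k2, k3⟩ := hmin q hxU
  have k4 := k3 x hxγ hxd
  obtain ⟨_, _, k5⟩ := hmin 0 h0U
  have k6 := k5 (g q) k1 k2
  rw [hg0] at k6
  simp only [inner_zero_left, sub_zero] at k6
  have k7 : ‖g q - xb‖ ≤ C * ‖q‖ := by
    have := hlip.norm_sub_le hxU h0U
    rw [hg0, sub_zero] at this
    nlinarith [norm_nonneg q]
  have k8 : ⟪q, g q - xb⟫ ≤ C * ‖q‖ ^ 2 := by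
    have := real_inner_le_norm q (g q - xb)
    nlinarith [norm_nonneg q]
  have k9 : ⟪q, x - xb⟫ = 1 / (2 * C) * ‖x - xb‖ ^ 2 := by
    rw [hqdef, real_inner_smul_left, real_inner_self_eq_norm_sq]
  have k10 : C * ‖q‖ ^ 2 = 1 / (4 * C) * ‖x - xb‖ ^ 2 := by
    rw [hqdef, norm_smul, Real.norm_of_nonneg (by positivity)]
    field_simp
    ring
  have k11 : 1 / (2 * C) * ‖x - xb‖ ^ 2 = 2 * (1 / (4 * C) * ‖x - xb‖ ^ 2) := by
    field_simp
    ring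
  rw [inner_sub_right] at k8 k9
  linarith

theorem feas_curve {n m : ℕ} (θ : CPWL m) (Φ : Ev n → Ev m) (xb : Ev n)
    (hPhi : ContDiffAt ℝ 2 Φ xb) (hdom : Φ xb ∈ θ.dom) (V : Submodule ℝ (Ev m))
    (hV : ∀ v ∈ θ.subdiff (Φ xb), v ∈ V)
    (hinj : ∀ v ∈ V, adjD Φ xb v = 0 → v = 0)
    (ξ : Ev n) (r : ℝ) (hI : ∀ i ∈ θ.Iact (Φ xb), ⟪θ.d i, fderiv ℝ Φ xb ξ⟫ ≤ 0)
    (hK : ∀ i ∈ θ.Kact (Φ xb), ⟪θ.a i, fderiv ℝ Φ xb ξ⟫ ≤ r) :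
    ∃ x : ℝ → Ev n, x 0 = xb ∧ HasDerivAt x ξ 0 ∧ ∀ᶠ t in 𝓝[>] (0 : ℝ),
      Φ (x t) ∈ θ.dom ∧ θ.val (Φ (x t)) ≤ θ.val (Φ xb) + t * r ∧
      ∀ v ∈ V, ⟪v, Φ (x t) - Φ xb⟫ = t * ⟪v, fderiv ℝ Φ xb ξ⟫ := by
  set A := fderiv ℝ Φ xb with hA
  have hs : HasStrictFDerivAt Φ A xb := hPhi.hasStrictFDerivAt (by norm_num)
  let P : Ev m →L[ℝ] V := V.orthogonalProjectionOnto
  let F' : Ev n →L[ℝ] V := P.comp A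
  have hF : HasStrictFDerivAt (fun x => P (Φ x)) F' xb := P.hasStrictFDerivAt.comp xb hs
  have hP : ∀ v (hv : v ∈ V) (y : Ev m), ⟪v, y⟫ = ⟪(⟨v, hv⟩ : V), P y⟫ := by
    intro v hv y
    exact (Submodule.inner_orthogonalProjectionOnto_eq_of_mem_left (⟨v, hv⟩ : V) y).symm
  have hsurj : F'.range = ⊤ := by
    rw [← Submodule.orthogonal_eq_bot_iff, Submodule.eq_bot_iff]
    intro v hv
    have h1 : adjD Φ xb (v : Ev m) = 0 := by
      refine ext_inner_right ℝ fun y => ?_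
      rw [adjD, ContinuousLinearMap.adjoint_inner_left, inner_zero_left, hP _ v.2]
      exact (Submodule.mem_orthogonal' _ _).1 hv (F' y) ⟨y, rfl⟩
    exact Subtype.ext (hinj v v.2 h1)
  obtain ⟨R, hR⟩ := LinearMap.exists_rightInverse_of_surjective (F' : Ev n →ₗ[ℝ] V) hsurj
  obtain ⟨x, hx0, hx, hev⟩ := submersion_curve (fun x => P (Φ x)) F'
    (LinearMap.toContinuousLinearMap R) (fun y => LinearMap.congr_fun hR y) xb hF ξ
  refine ⟨x, hx0, hx, ?_⟩
  have hxt : Tendsto x (𝓝[>] 0) (𝓝 xb) := by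
    have := hx.continuousAt.tendsto
    rw [hx0] at this
    exact this.mono_left nhdsWithin_le_nhds
  have hPt : Tendsto (fun t => Φ (x t)) (𝓝[>] 0) (𝓝 (Φ xb)) :=
    hPhi.continuousAt.tendsto.comp hxt
  obtain ⟨i0, hi0⟩ := θ.exists_act (Φ xb)
  have hi0m := θ.act_mem _ hdom _ hi0
  have hdV : ∀ i ∈ θ.Iact (Φ xb), θ.d i ∈ V := by
    intro i hi
    have h1 := hV _ (θ.add_mem _ _ hi0m i hi 1 zero_le_one)
    have h2 := V.sub_mem h1 (hV _ hi0m)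
    simpa using h2
  have hlin : ∀ᶠ t in 𝓝[>] (0 : ℝ), ∀ v ∈ V, ⟪v, Φ (x t) - Φ xb⟫ = t * ⟪v, A ξ⟫ := by
    filter_upwards [hev.filter_mono nhdsWithin_le_nhds] with t ht v hv
    rw [hP v hv, map_sub, ht, real_inner_smul_right, hP v hv]
    rfl
  have hinD : ∀ᶠ t in 𝓝[>] (0 : ℝ), ∀ i, i ∉ θ.Iact (Φ xb) → ⟪θ.d i, Φ (x t)⟫ < θ.be i := by
    rw [Filter.eventually_all]
    intro i
    by_cases hi : i ∈ θ.Iact (Φ xb)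
    · exact Eventually.of_forall fun t h => absurd hi h
    · have h1 : ⟪θ.d i, Φ xb⟫ < θ.be i := lt_of_le_of_ne (hdom i) hi
      filter_upwards [((tendsto_const_nhds (x := θ.d i)).inner hPt).eventually_lt_const h1] with t ht _ using ht
  have htr : Tendsto (fun t : ℝ => θ.val (Φ xb) + t * r) (𝓝[>] 0) (𝓝 (θ.val (Φ xb))) := by
    have : Continuous (fun t : ℝ => θ.val (Φ xb) + t * r) := by fun_prop
    have := this.tendsto 0
    simp only [zero_mul, add_zero] at this
    exact this.mono_left nhdsWithin_le_nhds
  have hinK : ∀ᶠ t in 𝓝[>] (0 : ℝ), ∀ i, i ∉ θ.Kact (Φ xb) →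
      ⟪θ.a i, Φ (x t)⟫ - θ.al i < θ.val (Φ xb) + t * r := by
    rw [Filter.eventually_all]
    intro i
    by_cases hi : i ∈ θ.Kact (Φ xb)
    · exact Eventually.of_forall fun t h => absurd hi h
    · have h1 : ⟪θ.a i, Φ xb⟫ - θ.al i < θ.val (Φ xb) :=
        lt_of_le_of_ne (θ.le_val _ i) (fun h => hi h.symm)
      filter_upwards [(((tendsto_const_nhds (x := θ.a i)).inner hPt).sub_const (θ.al i)).eventually_lt htr h1]
        with t ht _ using ht
  filter_upwards [hlin, hinD, hinK, self_mem_nhdsWithin] with t h1 h2 h3 ht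
  have ht : 0 < t := ht
  refine ⟨fun i => ?_, ?_, h1⟩
  · by_cases hi : i ∈ θ.Iact (Φ xb)
    · have h4 := h1 _ (hdV i hi)
      have h5 : ⟪θ.d i, Φ xb⟫ = θ.be i := hi
      rw [inner_sub_right] at h4
      nlinarith [hI i hi]
    · exact (h2 i hi).le
  · refine θ.val_le _ _ fun i => ?_
    by_cases hi : i ∈ θ.Kact (Φ xb)
    · have h4 := h1 _ (hV _ (θ.act_mem _ hdom i hi))
      have h5 : θ.val (Φ xb) = ⟪θ.a i, Φ xb⟫ - θ.al i := hi
      rw [inner_sub_right] at h4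
      nlinarith [hK i hi]
    · exact (h3 i hi).le

theorem exists_mult {n m : ℕ} (θ : CPWL m) (φ₀ : Ev n → ℝ) (Φ : Ev n → Ev m) (xb : Ev n)
    (hphi : ContDiffAt ℝ 2 φ₀ xb) (hPhi : ContDiffAt ℝ 2 Φ xb)
    (hdom : Φ xb ∈ θ.dom) (V : Submodule ℝ (Ev m))
    (hV : ∀ v ∈ θ.subdiff (Φ xb), v ∈ V)
    (hinj : ∀ v ∈ V, adjD Φ xb v = 0 → v = 0)
    (hmin : ∀ᶠ x in 𝓝 xb, Φ x ∈ θ.dom → φ₀ xb + θ.val (Φ xb) ≤ φ₀ x + θ.val (Φ x)) :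
    ∃ v, v ∈ LamCom φ₀ Φ θ xb := by
  by_contra hno
  let B : V →L[ℝ] Ev n := (adjD Φ xb).comp V.subtypeL
  have hBinj : (B : V →ₗ[ℝ] Ev n).ker = ⊥ := by
    rw [LinearMap.ker_eq_bot']
    intro v hv
    exact Subtype.ext (hinj v v.2 hv)
  let S : Set V := {v | (v : Ev m) ∈ θ.subdiff (Φ xb)}
  have hSc : IsClosed S := (θ.subdiff_closed _ hdom).preimage continuous_subtype_val
  have hSconv : Convex ℝ S := (θ.subdiff_convex (Φ xb)).linear_preimage V.subtype
  have hCc : IsClosed (B '' S) :=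
    (LinearMap.isClosedEmbedding_of_injective hBinj).isClosedMap _ hSc
  have hCconv : Convex ℝ (B '' S) := hSconv.linear_image (B : V →ₗ[ℝ] Ev n)
  have hnot : -gradient φ₀ xb ∉ B '' S := by
    rintro ⟨v, hv, hBv⟩
    have hBv : adjD Φ xb (v : Ev m) = -gradient φ₀ xb := hBv
    exact hno ⟨v, by rw [hBv]; simp, hv⟩
  obtain ⟨f, r, hf1, hf2⟩ := geometric_hahn_banach_closed_point hCconv hCc hnot
  set ξ : Ev n := (InnerProductSpace.toDual ℝ (Ev n)).symm f with hξ
  have hfi : ∀ y, f y = ⟪ξ, y⟫ := fun y => by simp [hξ]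
  have hsub : ∀ v ∈ θ.subdiff (Φ xb), ⟪v, fderiv ℝ Φ xb ξ⟫ < r := by
    intro v hv
    have h1 := hf1 (adjD Φ xb v) ⟨⟨v, hV v hv⟩, hv, rfl⟩
    rw [hfi, real_inner_comm, adjD, ContinuousLinearMap.adjoint_inner_left] at h1
    exact h1
  obtain ⟨i0, hi0⟩ := θ.exists_act (Φ xb)
  have hi0m := θ.act_mem _ hdom _ hi0
  have hI : ∀ i ∈ θ.Iact (Φ xb), ⟪θ.d i, fderiv ℝ Φ xb ξ⟫ ≤ 0 := by
    intro i hi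
    by_contra! hpos
    set a := ⟪θ.a i0, fderiv ℝ Φ xb ξ⟫ with ha
    have h0 := hsub _ hi0m
    have h1 := hsub _ (θ.add_mem _ _ hi0m i hi ((r - a) / ⟪θ.d i, fderiv ℝ Φ xb ξ⟫)
      (div_nonneg (by linarith) hpos.le))
    rw [inner_add_left, real_inner_smul_left, div_mul_cancel₀ _ hpos.ne'] at h1
    linarith
  obtain ⟨x, hx0, hx, hev⟩ := feas_curve θ Φ xb hPhi hdom V hV hinj ξ r hI
    (fun i hi => (hsub _ (θ.act_mem _ hdom i hi)).le)
  have hxt : Tendsto x (𝓝[>] 0) (𝓝 xb) := by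
    have := hx.continuousAt.tendsto
    rw [hx0] at this
    exact this.mono_left nhdsWithin_le_nhds
  have hφd : HasDerivAt (fun t => φ₀ (x t)) ⟪gradient φ₀ xb, ξ⟫ 0 := by
    have h1 := (hphi.differentiableAt (by norm_num)).hasGradientAt.hasFDerivAt
    rw [← hx0] at h1
    have h2 := h1.comp_hasDerivAt (0 : ℝ) hx
    rw [hx0] at h2
    exact h2
  have hsl : Tendsto (fun t : ℝ => t⁻¹ * (φ₀ (x t) - φ₀ xb)) (𝓝[>] 0)
      (𝓝 ⟪gradient φ₀ xb, ξ⟫) := by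
    have := hasDerivAt_iff_tendsto_slope_zero.1 hφd
    simp only [zero_add, hx0, smul_eq_mul] at this
    exact this.mono_left (nhdsWithin_mono _ fun t ht => ne_of_gt ht)
  have hle : -r ≤ ⟪gradient φ₀ xb, ξ⟫ := by
    refine ge_of_tendsto hsl ?_
    filter_upwards [hev, hxt.eventually hmin, self_mem_nhdsWithin] with t h1 h2 ht
    have ht : 0 < t := ht
    have h3 := h2 h1.1
    have h4 := h1.2.1
    rw [inv_mul_eq_div, le_div_iff₀ ht]
    linarith
  rw [hfi, inner_neg_right, real_inner_comm] at hf2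
  linarith

theorem crit_dir {m : ℕ} (θ : CPWL m) (zb vb u w : Ev m) (hvb : vb ∈ θ.subdiff zb)
    (h : w ∈ θ.Dsub zb vb u) :
    0 ≤ ⟪w, u⟫ ∧ (∀ i ∈ θ.Iact zb, ⟪θ.d i, u⟫ ≤ 0) ∧ ∀ i ∈ θ.Kact zb, ⟪θ.a i, u⟫ ≤ ⟪vb, u⟫ := by
  obtain ⟨zv, c, hmem, hc, hlim, hdir⟩ := h
  have hz : Tendsto (fun k => c k • ((zv k).1 - zb)) atTop (𝓝 u) :=
    (continuous_fst.tendsto _).comp hdir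
  have hw : Tendsto (fun k => c k • ((zv k).2 - vb)) atTop (𝓝 w) :=
    (continuous_snd.tendsto _).comp hdir
  have hv : Tendsto (fun k => (zv k).2) atTop (𝓝 vb) :=
    (continuous_snd.tendsto _).comp hlim
  have hzd : ∀ k, (zv k).1 ∈ θ.dom := fun k => (hmem k).1
  have hsg : ∀ k, θ.val (zv k).1 - θ.val zb ≤ ⟪(zv k).2, (zv k).1 - zb⟫ := by
    intro k
    have := (hmem k).2 zb hvb.1
    rw [← neg_sub (zv k).1 zb, inner_neg_right] at this
    linarith
  refine ⟨?_, ?_, ?_⟩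
  · refine ge_of_tendsto (hw.inner hz) (Eventually.of_forall fun k => ?_)
    have h1 := hvb.2 _ (hzd k)
    have h2 := hsg k
    rw [real_inner_smul_left, real_inner_smul_right, inner_sub_left]
    exact mul_nonneg (hc k) (mul_nonneg (hc k) (by linarith))
  · intro i hi
    refine le_of_tendsto ((tendsto_const_nhds (x := θ.d i)).inner hz) (Eventually.of_forall fun k => ?_)
    have h1 : ⟪θ.d i, zb⟫ = θ.be i := hi
    have h2 := hzd k i
    rw [real_inner_smul_right, inner_sub_right]
    exact mul_nonpos_of_nonneg_of_nonpos (hc k) (by linarith)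
  · intro i hi
    refine le_of_tendsto_of_tendsto ((tendsto_const_nhds (x := θ.a i)).inner hz) (hv.inner hz)
      (Eventually.of_forall fun k => ?_)
    have h1 : θ.val zb = ⟪θ.a i, zb⟫ - θ.al i := hi
    have h2 := θ.le_val (zv k).1 i
    have h3 := hsg k
    simp only [real_inner_smul_right]
    refine mul_le_mul_of_nonneg_left ?_ (hc k)
    rw [inner_sub_right (θ.a i)]
    linarith

theorem gradient_lagr {n m : ℕ} (φ₀ : Ev n → ℝ) (Φ : Ev n → Ev m) (xb : Ev n) (v : Ev m)
    (hphi : ContDiffAt ℝ 2 φ₀ xb) (hPhi : ContDiffAt ℝ 2 Φ xb) :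
    gradient (fun y => φ₀ y + ⟪Φ y, v⟫) xb = gradient φ₀ xb + adjD Φ xb v := by
  have h1 := (hphi.differentiableAt (by norm_num)).hasFDerivAt
  have h2 := (hPhi.differentiableAt (by norm_num)).hasFDerivAt
  have h3 := h1.add (h2.inner ℝ (hasFDerivAt_const v xb))
  refine ext_inner_right ℝ fun y => ?_
  have h4 : fderiv ℝ (fun y => φ₀ y + ⟪Φ y, v⟫) xb = _ := h3.fderiv
  rw [inner_add_left, adjD, ContinuousLinearMap.adjoint_inner_left, gradient, gradient,
    InnerProductSpace.toDual_symm_apply, InnerProductSpace.toDual_symm_apply, h4]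
  simp [real_inner_comm]

/-- under nondegeneracy, tilt stability yields a unique noncritical multiplier. -/
theorem stmt11 {n m : ℕ} (θ : CPWL m) (φ₀ : Ev n → ℝ) (Φ : Ev n → Ev m) (xb : Ev n)
    (hphi : ContDiffAt ℝ 2 φ₀ xb) (hPhi : ContDiffAt ℝ 2 Φ xb)
    (hdom : Φ xb ∈ θ.dom)
    (h0aff : (0 : Ev m) ∈ affineSpan ℝ (θ.subdiff (Φ xb)))
    (hnd : ((affineSpan ℝ (θ.subdiff (Φ xb)) : Set (Ev m)) ∩
        {v : Ev m | adjD Φ xb v = 0}) = {0})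
    (htilt : ∃ γ : ℝ, 0 < γ ∧ ∃ U ∈ 𝓝 (0 : Ev n),
      ∃ (g : Ev n → Ev n) (c : NNReal), LipschitzOnWith c g U ∧
        (∀ p₁ ∈ U, Mtilt φ₀ Φ θ xb γ p₁ = {g p₁}) ∧ g 0 = xb) :
    ∃ vb : Ev m, LamCom φ₀ Φ θ xb = {vb} ∧ ¬ IsCriticalCom φ₀ Φ θ xb vb := by
  obtain ⟨κ, hκ, hgrow⟩ := growth θ φ₀ Φ xb hdom htilt
  set V := (affineSpan ℝ (θ.subdiff (Φ xb))).direction with hVdef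
  have hVof : ∀ v ∈ affineSpan ℝ (θ.subdiff (Φ xb)), v ∈ V := by
    intro v hv
    simpa using AffineSubspace.vsub_mem_direction hv h0aff
  have hV : ∀ v ∈ θ.subdiff (Φ xb), v ∈ V := fun v hv =>
    hVof v (subset_affineSpan ℝ _ hv)
  have hinj : ∀ v ∈ V, adjD Φ xb v = 0 → v = 0 := by
    intro v hv h
    have h1 : v ∈ affineSpan ℝ (θ.subdiff (Φ xb)) := by
      simpa using AffineSubspace.vadd_mem_of_mem_direction hv h0aff
    have h2 : v ∈ ((affineSpan ℝ (θ.subdiff (Φ xb)) : Set (Ev m)) ∩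
        {v : Ev m | adjD Φ xb v = 0}) := ⟨h1, h⟩
    rw [hnd] at h2
    exact h2
  obtain ⟨vb, hvb⟩ := exists_mult θ φ₀ Φ xb hphi hPhi hdom V hV hinj (by
    filter_upwards [hgrow] with x hx hd
    have := hx hd
    have : 0 ≤ κ * ‖x - xb‖ ^ 2 := by positivity
    linarith)
  refine ⟨vb, ?_, ?_⟩
  · refine Set.eq_singleton_iff_unique_mem.2 ⟨hvb, fun v hv => ?_⟩
    refine sub_eq_zero.1 (hinj _ (V.sub_mem (hV _ hv.2) (hV _ hvb.2)) ?_)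
    rw [map_sub]
    have h1 := hv.1
    have h2 := hvb.1
    rw [← h2] at h1
    exact sub_eq_zero.2 (add_left_cancel h1)
  · rintro ⟨ξ, hξ, w, hw, heq⟩
    obtain ⟨h0, hI, hK⟩ := crit_dir θ _ _ _ _ hvb.2 hw
    obtain ⟨x, hx0, hx, hev⟩ := feas_curve θ Φ xb hPhi hdom V hV hinj ξ _ hI hK
    have hxt : Tendsto x (𝓝[>] 0) (𝓝 xb) := by
      have := hx.continuousAt.tendsto
      rw [hx0] at this
      exact this.mono_left nhdsWithin_le_nhds
    have hL : ContDiffAt ℝ 2 (fun y => φ₀ y + ⟪Φ y, vb⟫) xb :=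
      hphi.add (hPhi.inner ℝ contDiffAt_const)
    have hpos := second_order (fun y => φ₀ y + ⟪Φ y, vb⟫) xb ξ hL
      (by rw [gradient_lagr φ₀ Φ xb vb hphi hPhi]; exact hvb.1) κ hκ x hx0 hx hξ (by
        filter_upwards [hev, hxt.eventually hgrow] with t h1 h2
        have h3 := h2 h1.1
        have h4 := h1.2.1
        have h5 := h1.2.2 vb (hV _ hvb.2)
        rw [inner_sub_right, real_inner_comm, real_inner_comm (Φ xb)] at h5
        linarith)
    have hH : HessOp φ₀ Φ vb xb ξ = - adjD Φ xb w := eq_neg_of_add_eq_zero_left heq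
    have hpos : 0 < ⟪HessOp φ₀ Φ vb xb ξ, ξ⟫ := hpos
    rw [hH, inner_neg_left, adjD, ContinuousLinearMap.adjoint_inner_left] at hpos
    linarith
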